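/- (Uniform per-period Lyapunov decrease for admissible amplitudes.) Let n ≥ 1, T > 0, ω = 2π/T, S₁,…,S_m ∈ u(n), M ∈ ℕ, gains f₁,…,f_m > 0, and X_goal ∈ U(n) with det(I + X_goal) ≠ 0. Let a = (a_{k,ℓ}) ∈ ℝ^{mM} determine reference controls ū_k(t) = Σ_{ℓ=1}^M a_{k,ℓ} sin(ℓωt) and the T-periodic reference trajectory X̄ solving X̄' = Σ_k ū_k(t) S_k X̄, X̄(0) = X_goal; let X̃ : [0,∞) → U(n) solve the closed-loop error system X̃' = Σ_k ũ_k(X̃,t) X̄(t)†S_kX̄(t) X̃ with X̃(0) = X_goal, where ũ_k(X̃,t) = f_k Tr(X̃(X̃−I)(X̃+I)^{−3} X̄(t)†S_kX̄(t)). Assume a is admissible, i.e. lim_{t→∞} X̃(t) = I. Then there exist M_a > 0 and L ∈ ℕ such that for all integers j ≥ L, V(X̃((j+1)T)) − V(X̃(jT)) ≤ −M_a ‖X̃(jT) − I‖², where V(X̃) = −Tr((X̃−I)²(X̃+I)^{−2}) and ‖·‖ is the Frobenius norm. -/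

import Mathlib

open Matrix Filter

attribute [local instance] Matrix.frobeniusNormedAddCommGroup Matrix.frobeniusNormedSpace

/-- The feedback direction matrix `X̃ (X̃ - I) (X̃ + I)⁻³`. -/
noncomputable def fbMat {n : ℕ} (X : Matrix (Fin n) (Fin n) ℂ) : Matrix (Fin n) (Fin n) ℂ :=
  X * (X - 1) * ((X + 1)⁻¹ * (X + 1)⁻¹ * (X + 1)⁻¹)

/-- The feedback law `ũ_k(X̃, t) = f_k Tr (X̃(X̃-I)(X̃+I)⁻³ X̄(t)ᴴ S_k X̄(t))`
(the trace is real; we take its real part). -/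
noncomputable def utildeFb {n : ℕ} (f : ℝ) (Sk : Matrix (Fin n) (Fin n) ℂ)
    (Xbar : ℝ → Matrix (Fin n) (Fin n) ℂ) (Xt : Matrix (Fin n) (Fin n) ℂ) (t : ℝ) : ℝ :=
  f * ((fbMat Xt * ((Xbar t)ᴴ * Sk * Xbar t)).trace).re

/-- The Frobenius norm of a complex matrix. -/
noncomputable def frobNorm {n : ℕ} (A : Matrix (Fin n) (Fin n) ℂ) : ℝ :=
  Real.sqrt (∑ i, ∑ j, ‖A i j‖ ^ 2)

/-- The Lyapunov function `V(X̃) = -Tr ((X̃ - I)² (X̃ + I)⁻²)` (its value is real for unitary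
`X̃` with no eigenvalue `-1`; we take the real part). -/
noncomputable def lyapV {n : ℕ} (X : Matrix (Fin n) (Fin n) ℂ) : ℝ :=
  (-(((X - 1) * (X - 1)) * ((X + 1)⁻¹ * (X + 1)⁻¹)).trace).re


section abstractPart

variable {E F : Type*} [NormedAddCommGroup E] [InnerProductSpace ℝ E] [FiniteDimensional ℝ E]
  [NormedAddCommGroup F] [InnerProductSpace ℝ F] [FiniteDimensional ℝ F]

theorem aux_cauchy_schwarz (G : ℝ → ℝ) (s T : ℝ) (hT : 0 < T)
    (hG : ContinuousOn G (Set.Icc s (s + T))) :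
    (∫ t in s..(s+T), G t) ^ 2 ≤ T * ∫ t in s..(s+T), (G t) ^ 2 := by
  have hle : s ≤ s + T := by linarith
  have hu : ContinuousOn G (Set.uIcc s (s+T)) := by rwa [Set.uIcc_of_le hle]
  have i1 : IntervalIntegrable G MeasureTheory.volume s (s+T) := hu.intervalIntegrable
  have i2 : IntervalIntegrable (fun t => (G t)^2) MeasureTheory.volume s (s+T) :=
    (hu.pow 2).intervalIntegrable
  set Γ := ∫ t in s..(s+T), G t with hΓ
  have h0 : 0 ≤ ∫ t in s..(s+T), (G t - Γ / T) ^ 2 :=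
    intervalIntegral.integral_nonneg hle (fun t _ => sq_nonneg _)
  have h1 : ∫ t in s..(s+T), (G t - Γ / T) ^ 2
      = (∫ t in s..(s+T), (G t)^2) - 2 * (Γ / T) * Γ + T * (Γ/T)^2 := by
    have : (fun t => (G t - Γ / T) ^ 2) = fun t => ((G t)^2 - 2 * (Γ/T) * G t) + (Γ/T)^2 := by
      funext t; ring
    rw [this, intervalIntegral.integral_add (i2.sub (i1.const_mul _)) (by simp),
      intervalIntegral.integral_sub i2 (i1.const_mul _), intervalIntegral.integral_const_mul, ← hΓ]
    simp
  rw [h1] at h0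
  have h2 : T * ((∫ t in s..(s+T), (G t)^2) - 2 * (Γ / T) * Γ + T * (Γ/T)^2)
     = T * (∫ t in s..(s+T), (G t)^2) - Γ^2 := by
    field_simp; ring
  have := mul_nonneg hT.le h0
  linarith

theorem aux_observability (β : ℝ → E →L[ℝ] F) (hβ : Continuous β) (T : ℝ) (hT : 0 < T)
    (hper : ∀ t, β (t + T) = β t) :
    ∃ (p : E →L[ℝ] E) (c : ℝ), 0 < c ∧ (∀ v, ‖p v‖ ≤ ‖v‖) ∧ (∀ v, ‖v - p v‖ ≤ ‖v‖) ∧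
      (∀ v w, inner ℝ (p v) w = inner ℝ v (p w)) ∧ (∀ v, p (p v) = p v) ∧
      (∀ t v, β t (p v) = β t v) ∧
      (∀ s v, c * ‖p v‖ ^ 2 ≤ ∫ t in s..(s+T), ‖β t v‖ ^ 2) := by
  let N : Submodule ℝ E := ⨅ t, (β t).toLinearMap.ker
  have hN : ∀ v, v ∈ N ↔ ∀ t, β t v = 0 := by
    intro v; simp [N, Submodule.mem_iInf]
  let p := Nᗮ.starProjection
  have hsub : ∀ v, v - p v ∈ N := by
    intro v
    have := Submodule.sub_starProjection_mem_orthogonal (K := Nᗮ) v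
    rwa [Submodule.orthogonal_orthogonal] at this
  have hpβ : ∀ t v, β t (p v) = β t v := by
    intro t v
    have := (hN _).1 (hsub v) t
    rw [map_sub, sub_eq_zero] at this
    exact this.symm
  have hcontβ : Continuous fun x : E × ℝ => ‖β x.2 x.1‖ ^ 2 := by fun_prop
  have hpos : ∀ v ∈ Nᗮ, v ≠ 0 → 0 < ∫ t in (0:ℝ)..T, ‖β t v‖ ^ 2 := by
    intro v hv hv0
    have hne : ∃ t, β t v ≠ 0 := by
      by_contra! h
      have h1 : v ∈ N := (hN v).2 h
      have : v ∈ N ⊓ Nᗮ := ⟨h1, hv⟩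
      rw [Submodule.inf_orthogonal_eq_bot] at this
      exact hv0 (by simpa using this)
    obtain ⟨t, ht⟩ := hne
    have hfp : Function.Periodic β T := hper
    obtain ⟨t', ht', htt⟩ := hfp.exists_mem_Ico₀ hT t
    rw [htt] at ht
    have hc : Continuous fun t => ‖β t v‖ ^ 2 := hcontβ.comp (by fun_prop : Continuous fun t : ℝ => (v, t))
    apply intervalIntegral.integral_pos hT hc.continuousOn (fun _ _ => by positivity)
    exact ⟨t', ⟨ht'.1, ht'.2.le⟩, by positivity⟩
  have hq : Continuous fun v : E => ∫ t in (0:ℝ)..T, ‖β t v‖ ^ 2 :=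
    intervalIntegral.continuous_parametric_intervalIntegral_of_continuous' (f := fun (v : E) (t : ℝ) => ‖β t v‖^2) (by exact hcontβ) 0 T
  have hex : ∃ c : ℝ, 0 < c ∧ ∀ v ∈ Nᗮ, ‖v‖ = 1 → c ≤ ∫ t in (0:ℝ)..T, ‖β t v‖ ^ 2 := by
    have hK : IsCompact (Metric.sphere (0:E) 1 ∩ (Nᗮ : Set E)) :=
      (isCompact_sphere 0 1).inter_right (Submodule.closed_of_finiteDimensional _)
    rcases Set.eq_empty_or_nonempty (Metric.sphere (0:E) 1 ∩ (Nᗮ : Set E)) with h | h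
    · refine ⟨1, one_pos, fun v hv h1 => ?_⟩
      have : v ∈ (Metric.sphere (0:E) 1 ∩ (Nᗮ : Set E)) := ⟨by simpa using h1, hv⟩
      rw [h] at this; exact this.elim
    · obtain ⟨w, hw, hmin⟩ := hK.exists_isMinOn h hq.continuousOn
      refine ⟨_, hpos w hw.2 ?_, fun v hv h1 => hmin ⟨by simpa using h1, hv⟩⟩
      rintro rfl; simpa using hw.1
  obtain ⟨c, hc, hcv⟩ := hex
  refine ⟨p, c, hc, fun v => Submodule.norm_starProjection_apply_le _ _, ?_, ?_, ?_, hpβ, ?_⟩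
  · intro v
    have : v - p v = N.starProjection v := by
      have := Submodule.starProjection_orthogonal_val (K := N) v
      simp only [p, this]
      abel
    rw [this]
    exact Submodule.norm_starProjection_apply_le _ _
  · intro v w
    exact Submodule.inner_starProjection_left_eq_right _ _ _
  · intro v
    exact Submodule.starProjection_eq_self_iff.2 (Submodule.starProjection_apply_mem _ v)
  · intro s v
    have e1 : ∫ t in s..(s+T), ‖β t v‖ ^ 2 = ∫ t in (0:ℝ)..T, ‖β t (p v)‖ ^ 2 := by
      have hfp : Function.Periodic (fun t => ‖β t v‖^2) T := fun t => by simp [hper]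
      have := hfp.intervalIntegral_add_eq s 0
      rw [this]; simp [hpβ]
    rw [e1]
    by_cases h0 : p v = 0
    · simp [h0]
    have hnp : 0 < ‖p v‖ := norm_pos_iff.2 h0
    have h1 := hcv (‖p v‖⁻¹ • p v) (Submodule.smul_mem _ _ (Submodule.starProjection_apply_mem _ v))
      (by rw [norm_smul, norm_inv, norm_norm, inv_mul_cancel₀ hnp.ne'])
    have e2 : ∀ t, ‖β t (‖p v‖⁻¹ • p v)‖ ^ 2 = (‖p v‖⁻¹)^2 * ‖β t (p v)‖^2 := by
      intro t; rw [map_smul, norm_smul, norm_inv, norm_norm, mul_pow]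
    simp only [e2, intervalIntegral.integral_const_mul] at h1
    have := mul_le_mul_of_nonneg_right h1 (sq_nonneg ‖p v‖)
    calc c * ‖p v‖^2 ≤ _ := this
      _ = _ := by field_simp

/-- One-period estimates. -/
theorem aux_window (β : ℝ → E →L[ℝ] F) (hβ : Continuous β) (T : ℝ) (hT : 0 < T)
    (p : E →L[ℝ] E) (c : ℝ) (hc : 0 < c) (hp1 : ∀ v, ‖p v‖ ≤ ‖v‖) (hp2 : ∀ v, ‖v - p v‖ ≤ ‖v‖)
    (hps : ∀ v w, inner ℝ (p v) w = inner ℝ v (p w)) (hpp : ∀ v, p (p v) = p v)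
    (hpβ : ∀ t v, β t (p v) = β t v)
    (hobs : ∀ s v, c * ‖p v‖ ^ 2 ≤ ∫ t in s..(s+T), ‖β t v‖ ^ 2)
    (b : ℝ) (hb : 0 ≤ b) (hbβ : ∀ t, ‖β t‖ ≤ b)
    (κ : ℝ) (hκ : κ = c / (2 + 2 * b^2 * (b+1)^2 * T^2))
    (ε : ℝ) (hε0 : 0 ≤ ε) (hε1 : ε ≤ 1) (hε : 2 * ε * ((1/κ + T) / 2 + (b+1) * T) ≤ 1)
    (s : ℝ) (Y R : ℝ → E)
    (hY : ∀ t ∈ Set.Icc s (s+T),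
      HasDerivAt Y (-(ContinuousLinearMap.adjoint (β t) (β t (Y t))) + R t) t)
    (hRc : ContinuousOn R (Set.Icc s (s+T)))
    (hR : ∀ t ∈ Set.Icc s (s+T), ‖R t‖ ≤ ε * ‖β t (Y t)‖) :
    κ * ‖p (Y s)‖^2 ≤ ∫ t in s..(s+T), ‖β t (Y t)‖^2 ∧
    ‖p (Y (s+T))‖^2 ≤ ‖p (Y s)‖^2 - ∫ t in s..(s+T), ‖β t (Y t)‖^2 ∧
    ‖(Y (s+T) - p (Y (s+T))) - (Y s - p (Y s))‖ ≤
      ε * √T * √(∫ t in s..(s+T), ‖β t (Y t)‖^2) := by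
  have hle : s ≤ s + T := by linarith
  have hYc : ContinuousOn Y (Set.Icc s (s+T)) := fun t ht => (hY t ht).continuousAt.continuousWithinAt
  have hgc : ContinuousOn (fun t => β t (Y t)) (Set.Icc s (s+T)) := hβ.continuousOn.clm_apply hYc
  have hGc : ContinuousOn (fun t => ‖β t (Y t)‖) (Set.Icc s (s+T)) := hgc.norm
  have hadjc : Continuous fun t => ContinuousLinearMap.adjoint (β t) :=
    ContinuousLinearMap.adjoint.continuous.comp hβ
  have hDc : ContinuousOn (fun t => -(ContinuousLinearMap.adjoint (β t) (β t (Y t))) + R t)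
      (Set.Icc s (s+T)) := (hadjc.continuousOn.clm_apply hgc).neg.add hRc
  set D : ℝ → E := fun t => -(ContinuousLinearMap.adjoint (β t) (β t (Y t))) + R t with hD
  have hadjp : ∀ t g, p (ContinuousLinearMap.adjoint (β t) g) = ContinuousLinearMap.adjoint (β t) g := by
    intro t g
    refine ext_inner_right ℝ fun w => ?_
    rw [hps, ContinuousLinearMap.adjoint_inner_left, ContinuousLinearMap.adjoint_inner_left, hpβ]
  set Γ := ∫ t in s..(s+T), ‖β t (Y t)‖ with hΓ
  set I := ∫ t in s..(s+T), ‖β t (Y t)‖^2 with hI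
  have hΓ0 : 0 ≤ Γ := intervalIntegral.integral_nonneg hle (fun _ _ => norm_nonneg _)
  have hI0 : 0 ≤ I := intervalIntegral.integral_nonneg hle (fun _ _ => by positivity)
  have hCS : Γ^2 ≤ T * I := aux_cauchy_schwarz _ s T hT hGc
  have hiG : ∀ t ∈ Set.Icc s (s+T), IntervalIntegrable (fun t => ‖β t (Y t)‖) MeasureTheory.volume s t := by
    intro t ht
    apply ContinuousOn.intervalIntegrable
    rw [Set.uIcc_of_le ht.1]
    exact hGc.mono (Set.Icc_subset_Icc_right ht.2)
  have hpart : ∀ t ∈ Set.Icc s (s+T), ∫ r in s..t, ‖β r (Y r)‖ ≤ Γ := by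
    intro t ht
    apply intervalIntegral.integral_mono_interval le_rfl ht.1 ht.2
    · exact Eventually.of_forall fun _ => norm_nonneg _
    · exact hiG _ ⟨hle, le_rfl⟩
  -- general integral estimate
  have hest : ∀ (q : E →L[ℝ] E) (C : ℝ), 0 ≤ C → (∀ t ∈ Set.Icc s (s+T), ‖q (D t)‖ ≤ C * ‖β t (Y t)‖) →
      ∀ t ∈ Set.Icc s (s+T), ‖q (Y t) - q (Y s)‖ ≤ C * Γ := by
    intro q C hC hq t ht
    have hsubs : Set.uIcc s t ⊆ Set.Icc s (s+T) := by
      rw [Set.uIcc_of_le ht.1]; exact Set.Icc_subset_Icc_right ht.2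
    have e := intervalIntegral.integral_eq_sub_of_hasDerivAt (f := fun t => q (Y t))
      (f' := fun t => q (D t)) (a := s) (b := t)
      (fun r hr => q.hasFDerivAt.comp_hasDerivAt r (hY r (hsubs hr)))
      ((q.continuous.comp_continuousOn hDc).mono hsubs).intervalIntegrable
    rw [← e]
    calc ‖∫ r in s..t, q (D r)‖ ≤ ∫ r in s..t, C * ‖β r (Y r)‖ := by
          apply intervalIntegral.norm_integral_le_of_norm_le ht.1 _ ((hiG t ht).const_mul C)
          exact Eventually.of_forall fun r hr => hq r ⟨hr.1.le, hr.2.trans ht.2⟩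
      _ = C * ∫ r in s..t, ‖β r (Y r)‖ := intervalIntegral.integral_const_mul _ _
      _ ≤ C * Γ := mul_le_mul_of_nonneg_left (hpart t ht) hC
  have hy : ∀ t ∈ Set.Icc s (s+T), ‖p (Y t) - p (Y s)‖ ≤ (b+1) * Γ := by
    apply hest p (b+1) (by linarith)
    intro t ht
    refine (hp1 _).trans ((norm_add_le _ _).trans ?_)
    rw [norm_neg, add_mul]
    have a1 : ‖ContinuousLinearMap.adjoint (β t) (β t (Y t))‖ ≤ b * ‖β t (Y t)‖ := by
      refine (ContinuousLinearMap.le_opNorm _ _).trans ?_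
      rw [LinearIsometryEquiv.norm_map]
      exact mul_le_mul_of_nonneg_right (hbβ t) (norm_nonneg _)
    have a2 := hR t ht
    have a3 : ε * ‖β t (Y t)‖ ≤ 1 * ‖β t (Y t)‖ := mul_le_mul_of_nonneg_right hε1 (norm_nonneg _)
    linarith
  have hz := hest (ContinuousLinearMap.id ℝ E - p) ε hε0 (by
    intro t ht
    have : (ContinuousLinearMap.id ℝ E - p) (D t) = R t - p (R t) := by
      simp [hD, hadjp]
    rw [this]
    exact (hp2 _).trans (hR t ht)) (s+T) ⟨hle, le_rfl⟩
  have hden : 0 < 2 + 2 * b^2 * (b+1)^2 * T^2 := by positivity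
  have hκ0 : 0 < κ := by rw [hκ]; positivity
  have iG2 : IntervalIntegrable (fun t => ‖β t (Y t)‖^2) MeasureTheory.volume s (s+T) := by
    apply ContinuousOn.intervalIntegrable
    rw [Set.uIcc_of_le hle]; exact hGc.pow 2
  have first : κ * ‖p (Y s)‖^2 ≤ I := by
    have h1 := hobs s (Y s)
    have h2 : ∫ t in s..(s+T), ‖β t (Y s)‖ ^ 2 ≤
        ∫ t in s..(s+T), (2 * ‖β t (Y t)‖^2 + 2 * (b * ((b+1) * Γ))^2) := by
      apply intervalIntegral.integral_mono_on hle
      · apply Continuous.intervalIntegrable; fun_prop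
      · exact (iG2.const_mul 2).add (by simp)
      · intro t ht
        have e : β t (Y s) = β t (Y t) - β t (p (Y t) - p (Y s)) := by
          rw [map_sub, hpβ, hpβ]; abel
        have n1 : ‖β t (p (Y t) - p (Y s))‖ ≤ b * ((b+1)*Γ) :=
          ((β t).le_opNorm _).trans (mul_le_mul (hbβ t) (hy t ht) (norm_nonneg _) hb)
        have n2 : ‖β t (Y s)‖ ≤ ‖β t (Y t)‖ + b * ((b+1)*Γ) := by
          rw [e]; exact (norm_sub_le _ _).trans (by linarith)
        have n3 : ‖β t (Y s)‖^2 ≤ (‖β t (Y t)‖ + b * ((b+1)*Γ))^2 := by gcongr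
        nlinarith [sq_nonneg (‖β t (Y t)‖ - b * ((b+1)*Γ))]
    rw [intervalIntegral.integral_add (iG2.const_mul 2) (by simp),
      intervalIntegral.integral_const_mul] at h2
    simp only [intervalIntegral.integral_const, smul_eq_mul] at h2
    have h3 : c * ‖p (Y s)‖^2 ≤ (2 + 2 * b^2 * (b+1)^2 * T^2) * I := by
      have : (2 * b^2 * (b+1)^2 * T) * Γ^2 ≤ (2 * b^2 * (b+1)^2 * T) * (T * I) :=
        mul_le_mul_of_nonneg_left hCS (by positivity)
      nlinarith
    rw [hκ, div_mul_eq_mul_div, div_le_iff₀ hden]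
    linarith
  refine ⟨first, ?_, ?_⟩
  · have e := intervalIntegral.integral_eq_sub_of_hasDerivAt (f := fun t => ‖p (Y t)‖^2)
      (f' := fun t => 2 * inner ℝ (p (Y t)) (p (D t))) (a := s) (b := s+T)
      (fun r hr => by
        rw [Set.uIcc_of_le hle] at hr
        exact (p.hasFDerivAt.comp_hasDerivAt r (hY r hr)).norm_sq)
      (by
        apply ContinuousOn.intervalIntegrable
        rw [Set.uIcc_of_le hle]
        exact continuousOn_const.mul ((p.continuous.comp_continuousOn hYc).inner (p.continuous.comp_continuousOn hDc)))
    have h2 : ∫ t in s..(s+T), 2 * inner ℝ (p (Y t)) (p (D t)) ≤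
        ∫ t in s..(s+T), ((-2) * ‖β t (Y t)‖^2 + 2 * ε * (‖p (Y s)‖ + (b+1)*Γ) * ‖β t (Y t)‖) := by
      apply intervalIntegral.integral_mono_on hle
      · apply ContinuousOn.intervalIntegrable
        rw [Set.uIcc_of_le hle]
        exact continuousOn_const.mul ((p.continuous.comp_continuousOn hYc).inner (p.continuous.comp_continuousOn hDc))
      · exact (iG2.const_mul _).add ((hiG _ ⟨hle, le_rfl⟩).const_mul _)
      · intro t ht
        have e1 : inner ℝ (p (Y t)) (p (D t)) = -‖β t (Y t)‖^2 + inner ℝ (p (Y t)) (R t) := by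
          rw [← hps, hpp, hD]
          simp only [inner_add_right, inner_neg_right, ContinuousLinearMap.adjoint_inner_right, hpβ,
            real_inner_self_eq_norm_sq]
        have n1 : ‖p (Y t)‖ ≤ ‖p (Y s)‖ + (b+1)*Γ := by
          have := norm_le_norm_add_norm_sub' (p (Y t)) (p (Y s))
          linarith [hy t ht]
        have n2 : inner ℝ (p (Y t)) (R t) ≤ (‖p (Y s)‖ + (b+1)*Γ) * (ε * ‖β t (Y t)‖) :=
          (real_inner_le_norm _ _).trans (mul_le_mul n1 (hR t ht) (norm_nonneg _) (by positivity))
        rw [e1]; nlinarith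
    rw [e, intervalIntegral.integral_add (iG2.const_mul _) ((hiG _ ⟨hle, le_rfl⟩).const_mul _),
      intervalIntegral.integral_const_mul, intervalIntegral.integral_const_mul] at h2
    have h3 : ‖p (Y s)‖^2 ≤ (1/κ) * I := by
      rw [one_div, inv_mul_eq_div, le_div_iff₀ hκ0]; linarith
    have h4 : (‖p (Y s)‖ + (b+1)*Γ) * Γ ≤ ((1/κ + T)/2 + (b+1)*T) * I := by
      have := sq_nonneg (‖p (Y s)‖ - Γ)
      have h5 : (b+1)*Γ^2 ≤ (b+1)*(T*I) := mul_le_mul_of_nonneg_left hCS (by linarith)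
      nlinarith
    have h5 : 2 * ε * ((‖p (Y s)‖ + (b+1)*Γ) * Γ) ≤ 2 * ε * (((1/κ + T)/2 + (b+1)*T) * I) :=
      mul_le_mul_of_nonneg_left h4 (by positivity)
    have h6 := mul_le_mul_of_nonneg_right hε hI0
    nlinarith
  · have : Γ ≤ √T * √I := by
      rw [← Real.sqrt_mul hT.le]
      exact Real.le_sqrt_of_sq_le hCS
    calc _ = ‖(ContinuousLinearMap.id ℝ E - p) (Y (s+T)) - (ContinuousLinearMap.id ℝ E - p) (Y s)‖ := by simp
      _ ≤ ε * Γ := hz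
      _ ≤ ε * (√T * √I) := mul_le_mul_of_nonneg_left this hε0
      _ = _ := by ring

/-- Sequence argument. -/
theorem aux_sequence (y I : ℕ → ℝ) (z : ℕ → E) (κ C : ℝ) (hκ : 0 < κ) (hC : 0 ≤ C)
    (hCκ : 2 * C ≤ √κ) (L : ℕ)
    (hy0 : ∀ j, 0 ≤ y j)
    (h1 : ∀ j ≥ L, κ * y j ^ 2 ≤ I j) (h2 : ∀ j ≥ L, y (j+1)^2 ≤ y j ^2 - I j)
    (h3 : ∀ j ≥ L, ‖z (j+1) - z j‖ ≤ C * √(I j))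
    (hz : Tendsto z atTop (nhds 0)) : ∀ j ≥ L, ‖z j‖ ≤ y j := by
  have step : ∀ j ≥ L, ‖z (j+1) - z j‖ ≤ y j - y (j+1) := by
    intro j hj
    have hI0 : 0 ≤ I j := le_trans (by positivity) (h1 j hj)
    have hIs := Real.sq_sqrt hI0
    have hI1 := Real.sqrt_nonneg (I j)
    have hle : y (j+1) ≤ y j := by
      refine (sq_le_sq₀ (hy0 _) (hy0 _)).1 ?_
      linarith [h2 j hj]
    refine (h3 j hj).trans ?_
    have hκs : √κ * y j ≤ √(I j) := by
      apply Real.le_sqrt_of_sq_le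
      rw [mul_pow, Real.sq_sqrt hκ.le]; exact h1 j hj
    rcases (hy0 j).eq_or_lt with h | h
    · have a : I j ≤ 0 := by nlinarith [h2 j hj, sq_nonneg (y (j+1))]
      have b : √(I j) = 0 := Real.sqrt_eq_zero_of_nonpos a
      rw [b]; linarith
    · have a : √(I j) * (√κ * y j) ≤ 2 * y j * (y j - y (j+1)) := by
        have := mul_le_mul_of_nonneg_left hκs hI1
        nlinarith [h2 j hj, hy0 (j+1)]
      have b : √(I j) * (2 * C * y j) ≤ √(I j) * (√κ * y j) := by gcongr
      have c : y j * (C * √(I j)) ≤ y j * (y j - y (j+1)) := by nlinarith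
      exact le_of_mul_le_mul_left c h
  intro j hj
  have tele : ∀ i, ‖z (j+i) - z j‖ ≤ y j - y (j+i) := by
    intro i
    induction i with
    | zero => simp
    | succ i ih =>
      have a := step (j+i) (by omega)
      have b : z (j+(i+1)) - z j = (z (j+i+1) - z (j+i)) + (z (j+i) - z j) := by
        rw [← add_assoc]; abel
      rw [b]
      refine (norm_add_le _ _).trans ?_
      rw [← add_assoc]; linarith
  have hlim : Tendsto (fun i => ‖z (j+i) - z j‖) atTop (nhds ‖0 - z j‖) := by
    have := (tendsto_add_atTop_iff_nat j).2 hz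
    simp only [add_comm _ j] at this
    exact (this.sub_const _).norm
  have := le_of_tendsto' hlim (fun i => (tele i).trans (by linarith [hy0 (j+i)] : _ ≤ y j))
  simpa using this

theorem aux_main (β : ℝ → E →L[ℝ] F) (hβ : Continuous β) (T : ℝ) (hT : 0 < T)
    (hper : ∀ t, β (t + T) = β t) (K t0 : ℝ) (hK : 0 ≤ K) (Y R : ℝ → E)
    (hY : ∀ t ≥ t0,
      HasDerivAt Y (-(ContinuousLinearMap.adjoint (β t) (β t (Y t))) + R t) t)
    (hRc : ContinuousOn R (Set.Ici t0))
    (hR' : ∀ t ≥ t0, ‖R t‖ ≤ K * ‖Y t‖ * ‖ContinuousLinearMap.adjoint (β t) (β t (Y t))‖)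
    (hlim : Tendsto Y atTop (nhds 0)) :
    ∃ (c : ℝ) (L : ℕ), 0 < c ∧ ∀ j : ℕ, L ≤ j →
      c * ‖Y (j * T)‖^2 ≤ ∫ t in (j*T : ℝ)..(j*T+T), ‖β t (Y t)‖^2 := by
  obtain ⟨p, c, hc, hp1, hp2, hps, hpp, hpβ, hobs⟩ := aux_observability β hβ T hT hper
  obtain ⟨b, hb, hbβ⟩ : ∃ b, 0 ≤ b ∧ ∀ t, ‖β t‖ ≤ b := by
    obtain ⟨b, hb⟩ := (isCompact_Icc (a := (0:ℝ)) (b := T)).exists_bound_of_continuousOn hβ.continuousOn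
    have hfp : Function.Periodic β T := hper
    refine ⟨b, (norm_nonneg _).trans (hb 0 ⟨le_rfl, hT.le⟩), fun t => ?_⟩
    obtain ⟨t', ht', htt⟩ := hfp.exists_mem_Ico₀ hT t
    rw [htt]; exact hb t' ⟨ht'.1, ht'.2.le⟩
  have hR : ∀ t ≥ t0, ‖R t‖ ≤ (K * b) * ‖Y t‖ * ‖β t (Y t)‖ := by
    intro t ht
    have a1 : ‖ContinuousLinearMap.adjoint (β t) (β t (Y t))‖ ≤ b * ‖β t (Y t)‖ := by
      refine (ContinuousLinearMap.le_opNorm _ _).trans ?_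
      rw [LinearIsometryEquiv.norm_map]
      exact mul_le_mul_of_nonneg_right (hbβ t) (norm_nonneg _)
    refine (hR' t ht).trans ((mul_le_mul_of_nonneg_left a1 (by positivity)).trans (le_of_eq ?_))
    ring
  obtain ⟨κ, hκ⟩ : ∃ κ, κ = c / (2 + 2 * b^2 * (b+1)^2 * T^2) := ⟨_, rfl⟩
  have hκ0 : 0 < κ := by rw [hκ]; positivity
  obtain ⟨ε, hε0, hε1, hε2, hε3⟩ : ∃ ε : ℝ, 0 < ε ∧ ε ≤ 1 ∧
      2 * ε * ((1/κ + T) / 2 + (b+1) * T) ≤ 1 ∧ 2 * (ε * √T) ≤ √κ := by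
    have hA : 0 < 2 * ((1/κ + T) / 2 + (b+1) * T) := by positivity
    have hB : 0 < 2 * √T := by positivity
    have hs : 0 < √κ := by positivity
    refine ⟨min 1 (min (1 / (2 * ((1/κ + T) / 2 + (b+1) * T))) (√κ / (2 * √T))), by positivity, min_le_left _ _, ?_, ?_⟩
    · have := (min_le_right 1 (min (1 / (2 * ((1/κ + T) / 2 + (b+1) * T))) (√κ / (2 * √T)))).trans (min_le_left _ _)
      rw [le_div_iff₀ hA] at this
      linarith
    · have := (min_le_right 1 (min (1 / (2 * ((1/κ + T) / 2 + (b+1) * T))) (√κ / (2 * √T)))).trans (min_le_right _ _)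
      rw [le_div_iff₀ hB] at this
      linarith
  have hKY : Tendsto (fun t => (K * b) * ‖Y t‖) atTop (nhds 0) := by
    simpa using (hlim.norm.const_mul (K * b))
  obtain ⟨t1, ht1⟩ := eventually_atTop.1 (hKY.eventually (gt_mem_nhds hε0))
  have hTt : Tendsto (fun j : ℕ => (j : ℝ) * T) atTop atTop :=
    tendsto_natCast_atTop_atTop.atTop_mul_const hT
  obtain ⟨L, hL⟩ := eventually_atTop.1 (hTt.eventually_ge_atTop (max t0 t1))
  have W : ∀ j ≥ L, _ := fun j hj => aux_window β hβ T hT p c hc hp1 hp2 hps hpp hpβ hobs b hb hbβ κ hκ ε hε0.le hε1 hε2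
    (j * T) Y R (fun t ht => hY t ((le_max_left _ _).trans ((hL j hj).trans ht.1)))
    (hRc.mono fun t ht => (le_max_left _ _).trans ((hL j hj).trans ht.1))
    (fun t ht => (hR t ((le_max_left _ _).trans ((hL j hj).trans ht.1))).trans
      (mul_le_mul_of_nonneg_right (ht1 t ((le_max_right _ _).trans ((hL j hj).trans ht.1))).le (norm_nonneg _)))
  have hcast : ∀ j : ℕ, (j:ℝ) * T + T = ((j+1 : ℕ) : ℝ) * T := by intro j; push_cast; ring
  have S := aux_sequence (E := E) (fun j => ‖p (Y (j*T))‖) (fun j => ∫ t in (j*T : ℝ)..(j*T+T), ‖β t (Y t)‖^2)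
    (fun j => Y (j*T) - p (Y (j*T))) κ (ε * √T) hκ0 (by positivity) hε3 L (fun _ => norm_nonneg _)
    (fun j hj => (W j hj).1) (fun j hj => by have := (W j hj).2.1; rw [hcast j] at this ⊢; exact this)
    (fun j hj => by have := (W j hj).2.2; rw [hcast j] at this ⊢; exact this)
    (by
      have h := hlim.comp hTt
      have h2 := (p.continuous.tendsto 0).comp h
      simpa using h.sub h2)
  refine ⟨κ / 4, L, by positivity, fun j hj => ?_⟩
  have s1 := S j hj
  have s2 := (W j hj).1
  have s3 : ‖Y (j*T)‖ ≤ 2 * ‖p (Y (j*T))‖ := by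
    have := norm_le_norm_add_norm_sub' (Y (j*T)) (p (Y (j*T)))
    linarith
  have s4 : ‖Y (j*T)‖^2 ≤ (2 * ‖p (Y (j*T))‖)^2 := by gcongr
  nlinarith

end abstractPart
section algebraPart

variable {𝔸 : Type*} [NormedRing 𝔸] [NormedAlgebra ℝ 𝔸] [CompleteSpace 𝔸]

theorem aux_hasDerivAt_inverse (X : ℝ → 𝔸) (X' : 𝔸) (t : ℝ) (hX : HasDerivAt X X' t)
    (hu : IsUnit (X t)) :
    HasDerivAt (fun t => Ring.inverse (X t)) (-(Ring.inverse (X t) * X' * Ring.inverse (X t))) t := by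
  obtain ⟨u, hu⟩ := hu
  have h := hasFDerivAt_ringInverse (𝕜 := ℝ) u
  rw [hu] at h
  have := h.comp_hasDerivAt t hX
  rw [← hu]
  have e : -(Ring.inverse (u:𝔸) * X' * Ring.inverse (u:𝔸)) =
      (-ContinuousLinearMap.mulLeftRight ℝ 𝔸 (↑u⁻¹) (↑u⁻¹)) X' := by simp [Ring.inverse_unit]
  rw [e]
  exact this

/-- Derivative of `H = (X+1)⁻¹ - 1/2` -/
theorem aux_H_deriv (X : ℝ → 𝔸) (A : 𝔸) (t : ℝ) (hX : HasDerivAt X (A * X t) t)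
    (hu : IsUnit (X t + 1)) (H : ℝ → 𝔸) (hH : ∀ t, H t = Ring.inverse (X t + 1) - (1/2 : ℝ) • 1) :
    HasDerivAt H (-((1/4:ℝ) • A) + (1/2:ℝ) • (A * H t) - (1/2:ℝ) • (H t * A) + H t * A * H t) t := by
  have h1 := (aux_hasDerivAt_inverse (fun t => X t + 1) (A * X t) t (hX.add_const 1) hu).sub_const
    ((1/2 : ℝ) • (1 : 𝔸))
  have e : (fun t => Ring.inverse (X t + 1) - (1/2:ℝ) • (1:𝔸)) = H := by funext t; rw [hH]
  simp only [e] at h1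
  refine HasDerivAt.congr_deriv h1 ?_
  have hJ : Ring.inverse (X t + 1) = H t + (1/2:ℝ) • 1 := by rw [hH]; abel
  have hXJ : X t * Ring.inverse (X t + 1) = 1 - Ring.inverse (X t + 1) := by
    have := Ring.mul_inverse_cancel _ hu
    rw [add_mul, one_mul] at this
    exact eq_sub_of_add_eq this
  rw [← mul_assoc, mul_assoc _ (X t), hXJ, hJ]
  simp only [add_mul, mul_sub, mul_add, smul_mul_assoc, mul_smul_comm, one_mul, mul_one, smul_add, smul_smul]
  module

/-- Derivative of `F = -H/2 + 2 H³` with remainder bound -/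
theorem aux_F_deriv (H : ℝ → 𝔸) (A : 𝔸) (t : ℝ)
    (hH : HasDerivAt H (-((1/4:ℝ) • A) + (1/2:ℝ) • (A * H t) - (1/2:ℝ) • (H t * A) + H t * A * H t) t)
    (D : 𝔸) (hD : D = -((1/4:ℝ) • A) + (1/2:ℝ) • (A * H t) - (1/2:ℝ) • (H t * A) + H t * A * H t) :
    HasDerivAt (fun t => -((1/2:ℝ) • H t) + (2:ℝ) • (H t * H t * H t))
      ((1/8:ℝ) • A + (-((1/4:ℝ) • (A * H t)) + (1/4:ℝ) • (H t * A) - (1/2:ℝ) • (H t * A * H t)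
        + (2:ℝ) • (D * H t * H t + H t * D * H t + H t * H t * D))) t := by
  rw [← hD] at hH
  have h := ((hH.const_smul (1/2:ℝ)).neg).add (((hH.mul hH).mul hH).const_smul (2:ℝ))
  refine HasDerivAt.congr_deriv h ?_
  simp only [Pi.mul_apply]
  have e : -((1/2:ℝ) • D) = (1/8:ℝ) • A + (-((1/4:ℝ) • (A * H t)) + (1/4:ℝ) • (H t * A)
      - (1/2:ℝ) • (H t * A * H t)) := by rw [hD]; module
  rw [e, add_mul]
  module

theorem aux_R_bound (H A D : 𝔸) (hH : ‖H‖ ≤ 1)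
    (hD : D = -((1/4:ℝ) • A) + (1/2:ℝ) • (A * H) - (1/2:ℝ) • (H * A) + H * A * H) :
    ‖(-((1/4:ℝ) • (A * H)) + (1/4:ℝ) • (H * A) - (1/2:ℝ) • (H * A * H)
        + (2:ℝ) • (D * H * H + H * D * H + H * H * D))‖ ≤ 20 * ‖H‖ * ‖A‖ := by
  have hs : ∀ (r : ℝ) (x : 𝔸), 0 ≤ r → ‖r • x‖ = r * ‖x‖ := fun r x hr => by
    rw [norm_smul, Real.norm_of_nonneg hr]
  have n0 := norm_nonneg H
  have nA := norm_nonneg A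
  have nD0 := norm_nonneg D
  have hAH : ‖A * H‖ ≤ ‖H‖ * ‖A‖ := (norm_mul_le _ _).trans (mul_comm _ _).le
  have hHA : ‖H * A‖ ≤ ‖H‖ * ‖A‖ := norm_mul_le _ _
  have hHAH : ‖H * A * H‖ ≤ ‖H‖ * ‖A‖ := by
    calc _ ≤ ‖H * A‖ * ‖H‖ := norm_mul_le _ _
      _ ≤ (‖H‖ * ‖A‖) * 1 := mul_le_mul hHA hH n0 (by positivity)
      _ = _ := mul_one _
  have hDn : ‖D‖ ≤ 3 * ‖A‖ := by
    rw [hD]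
    have a1 := norm_add_le (-((1/4:ℝ) • A) + (1/2:ℝ) • (A * H) - (1/2:ℝ) • (H * A)) (H * A * H)
    have a2 := norm_sub_le (-((1/4:ℝ) • A) + (1/2:ℝ) • (A * H)) ((1/2:ℝ) • (H * A))
    have a3 := norm_add_le (-((1/4:ℝ) • A)) ((1/2:ℝ) • (A * H))
    rw [norm_neg, hs _ _ (by norm_num), hs _ _ (by norm_num)] at a3
    rw [hs _ (H*A) (by norm_num)] at a2
    have : ‖H‖ * ‖A‖ ≤ 1 * ‖A‖ := mul_le_mul_of_nonneg_right hH nA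
    linarith
  have tri : ∀ x y z : 𝔸, ‖x * y * z‖ ≤ ‖x‖ * ‖y‖ * ‖z‖ := fun x y z =>
    (norm_mul_le _ _).trans (mul_le_mul_of_nonneg_right (norm_mul_le _ _) (norm_nonneg _))
  have hHHD : ‖H‖ * ‖H‖ * ‖D‖ ≤ ‖H‖ * (3 * ‖A‖) := by
    have : ‖H‖ * ‖H‖ ≤ ‖H‖ * 1 := mul_le_mul_of_nonneg_left hH n0
    rw [mul_one] at this
    exact mul_le_mul this hDn nD0 n0
  have d1 := tri D H H
  have d2 := tri H D H
  have d3 := tri H H D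
  have b1 := norm_add_le (-((1/4:ℝ) • (A * H)) + (1/4:ℝ) • (H * A) - (1/2:ℝ) • (H * A * H))
    ((2:ℝ) • (D * H * H + H * D * H + H * H * D))
  have b2 := norm_sub_le (-((1/4:ℝ) • (A * H)) + (1/4:ℝ) • (H * A)) ((1/2:ℝ) • (H * A * H))
  have b3 := norm_add_le (-((1/4:ℝ) • (A * H))) ((1/4:ℝ) • (H * A))
  have b4 := norm_add_le (D * H * H + H * D * H) (H * H * D)
  have b5 := norm_add_le (D * H * H) (H * D * H)
  rw [hs _ _ (by norm_num)] at b1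
  rw [hs _ (H * A * H) (by norm_num)] at b2
  rw [norm_neg, hs _ _ (by norm_num), hs _ _ (by norm_num)] at b3
  have : 0 ≤ ‖H‖ * ‖A‖ := by positivity
  nlinarith

theorem aux_F_lower (H : 𝔸) (hH : ‖H‖ ≤ 1/4) :
    ‖H‖ ≤ 4 * ‖-((1/2:ℝ) • H) + (2:ℝ) • (H * H * H)‖ := by
  have n0 := norm_nonneg H
  have h1 : ‖(2:ℝ) • (H * H * H)‖ ≤ 2 * (‖H‖ * ‖H‖ * ‖H‖) := by
    rw [norm_smul, Real.norm_of_nonneg (by norm_num)]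
    have : ‖H * H * H‖ ≤ ‖H‖ * ‖H‖ * ‖H‖ :=
      (norm_mul_le _ _).trans (mul_le_mul_of_nonneg_right (norm_mul_le _ _) (norm_nonneg _))
    linarith
  have h2 : ‖(1/2:ℝ) • H‖ = 1/2 * ‖H‖ := by
    rw [norm_smul, Real.norm_of_nonneg (by norm_num)]
  have h3 := norm_sub_norm_le ((1/2:ℝ) • H) ((2:ℝ) • (H * H * H))
  have h4 : ‖-((1/2:ℝ) • H) + (2:ℝ) • (H * H * H)‖ = ‖(1/2:ℝ) • H - (2:ℝ) • (H * H * H)‖ := by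
    rw [← norm_neg]; congr 1; abel
  rw [h4]
  have h5 : ‖H‖ * ‖H‖ * ‖H‖ ≤ 1/4 * (1/4) * ‖H‖ := by gcongr
  linarith

end algebraPart

section matrixPart

attribute [local instance] Matrix.frobeniusNormedRing Matrix.frobeniusNormedAlgebra

variable {n : ℕ}

local notation "𝓜" => Matrix (Fin n) (Fin n) ℂ

theorem aux_star_deriv (X : ℝ → 𝓜) (X' : 𝓜) (s : Set ℝ) (t : ℝ) (h : HasDerivWithinAt X X' s t) :
    HasDerivWithinAt (fun t => (X t)ᴴ) X'ᴴ s t := by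
  exact h.star

theorem aux_mul_deriv (X Y : ℝ → 𝓜) (X' Y' : 𝓜) (s : Set ℝ) (t : ℝ) (h : HasDerivWithinAt X X' s t)
    (h2 : HasDerivWithinAt Y Y' s t) :
    HasDerivWithinAt (fun t => X t * Y t) (X' * Y t + X t * Y') s t := by
  exact h.mul h2

/-- solutions of a skew equation have constant Gram matrix -/
theorem aux_gram (X : ℝ → 𝓜) (A : ℝ → 𝓜) (hA : ∀ t, (A t)ᴴ = -(A t)) (s : Set ℝ) (t : ℝ)
    (h : HasDerivWithinAt X (A t * X t) s t) :
    HasDerivWithinAt (fun t => (X t)ᴴ * X t) 0 s t := by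
  refine (aux_mul_deriv _ _ _ _ s t (aux_star_deriv _ _ s t h) h).congr_deriv ?_
  rw [conjTranspose_mul, hA]
  noncomm_ring

theorem aux_gram_const (X : ℝ → 𝓜) (A : ℝ → 𝓜) (hA : ∀ t, (A t)ᴴ = -(A t)) (a : ℝ)
    (h : ∀ t ∈ Set.Ici a, HasDerivWithinAt X (A t * X t) (Set.Ici a) t) (t : ℝ) (ht : a ≤ t) :
    (X t)ᴴ * X t = (X a)ᴴ * X a := by
  have hg := fun t ht => aux_gram X A hA (Set.Ici a) t (h t ht)
  have hc : ContinuousOn (fun t => (X t)ᴴ * X t) (Set.Icc a t) :=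
    fun r hr => (hg r hr.1).continuousWithinAt.mono (fun x hx => hx.1)
  exact constant_of_has_deriv_right_zero hc
    (fun r hr => (hg r hr.1).mono (Set.Ici_subset_Ici.2 hr.1)) t ⟨ht, le_rfl⟩

open scoped ComplexOrder in
theorem aux_reflect (X : ℝ → 𝓜) (A : ℝ → 𝓜) (hA : ∀ t, (A t)ᴴ = -(A t)) (c : ℝ)
    (hodd : ∀ t, A (2 * c - t) = -(A t))
    (h : ∀ t, HasDerivAt X (A t * X t) t) (t : ℝ) : X (2 * c - t) = X t := by
  have key : ∀ t, c ≤ t → X (2 * c - t) = X t := by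
    intro t ht
    have hD : ∀ r, HasDerivAt (fun r => X (2 * c - r) - X r) (A r * (X (2 * c - r) - X r)) r := by
      intro r
      have h1 := (h (2 * c - r)).scomp r ((hasDerivAt_id r).const_sub (2*c))
      refine (h1.sub (h r)).congr_deriv ?_
      rw [hodd]
      simp [mul_sub]
    have := aux_gram_const _ A hA c (fun r _ => (hD r).hasDerivWithinAt) t ht
    have e : X (2 * c - c) - X c = 0 := by
      rw [show 2 * c - c = c by ring, sub_self]
    rw [e, mul_zero, conjTranspose_mul_self_eq_zero] at this
    exact sub_eq_zero.1 this
  rcases le_total c t with ht | ht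
  · exact key t ht
  · have := key (2 * c - t) (by linarith)
    rw [show 2 * c - (2 * c - t) = t by ring] at this
    exact this.symm

theorem aux_periodic (m M : ℕ) (T : ℝ) (hT : 0 < T)
    (S : Fin m → 𝓜) (hS : ∀ k, (S k)ᴴ = -(S k))
    (a : Fin m → Fin M → ℝ)
    (ubar : Fin m → ℝ → ℝ)
    (hubar : ubar = fun k t =>
      ∑ ℓ : Fin M, a k ℓ * Real.sin ((ℓ.1 + 1) * (2 * Real.pi / T) * t))
    (Xbar : ℝ → 𝓜)
    (hXbarode : ∀ t, HasDerivAt Xbar (∑ k, ubar k t • (S k * Xbar t)) t) (t : ℝ) :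
    Xbar (t + T) = Xbar t := by
  let A : ℝ → 𝓜 := fun t => ∑ k, ubar k t • S k
  have hA : ∀ t, (A t)ᴴ = -(A t) := by
    intro t
    simp [A, conjTranspose_sum, conjTranspose_smul, hS]
  have hode : ∀ t, HasDerivAt Xbar (A t * Xbar t) t := by
    intro t
    refine (hXbarode t).congr_deriv ?_
    simp [A, Finset.sum_mul]
  have o1 : ∀ t, A (2 * 0 - t) = -(A t) := by
    intro t
    simp [A, hubar, Finset.sum_neg_distrib]
  have o2 : ∀ t, A (2 * (T/2) - t) = -(A t) := by
    intro t
    have : ∀ k, ubar k (2 * (T/2) - t) = - ubar k t := by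
      intro k
      rw [hubar]
      simp only
      rw [← Finset.sum_neg_distrib]
      refine Finset.sum_congr rfl fun ℓ _ => ?_
      have e : ((ℓ.1:ℝ) + 1) * (2 * Real.pi / T) * (2 * (T/2) - t)
          = ((ℓ.1 + 1 : ℕ) : ℝ) * (2 * Real.pi) - ((ℓ.1:ℝ) + 1) * (2 * Real.pi / T) * t := by
        push_cast; field_simp
      rw [e, Real.sin_nat_mul_two_pi_sub]; ring
    simp [A, this, Finset.sum_neg_distrib]
  have r1 := aux_reflect Xbar A hA 0 o1 hode t
  have r2 := aux_reflect Xbar A hA (T/2) o2 hode (t + T)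
  rw [← r2, ← r1]
  congr 1; ring

/-- `F` in terms of `H`, skewness and `V`. -/
theorem aux_mat_identities (X H : 𝓜) (hu : IsUnit (X + 1))
    (hH : H = Ring.inverse (X + 1) - (1/2:ℝ) • 1) :
    fbMat X = -((1/2:ℝ) • H) + (2:ℝ) • (H * H * H) ∧
    lyapV X = -(4 * (H * H).trace.re) ∧ X - 1 = -((2:ℝ) • (H * (X + 1))) ∧
    (Xᴴ * X = 1 → Hᴴ = -H) := by
  have hJ : (X+1)⁻¹ = H + (1/2:ℝ) • 1 := by
    rw [hH, nonsing_inv_eq_ringInverse]; abel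
  have hdet : IsUnit (X+1).det := (isUnit_iff_isUnit_det _).1 hu
  have c1 : (X+1) * (H + (1/2:ℝ) • 1) = 1 := by rw [← hJ]; exact mul_nonsing_inv _ hdet
  have c2 : (H + (1/2:ℝ) • 1) * (X+1) = 1 := by rw [← hJ]; exact nonsing_inv_mul _ hdet
  have x1 : X * (H + (1/2:ℝ) • 1) = (1/2:ℝ) • 1 - H := by
    have : X * (H + (1/2:ℝ) • 1) = (X+1) * (H + (1/2:ℝ) • 1) - (H + (1/2:ℝ) • 1) := by
      rw [add_mul, one_mul]; abel
    rw [this, c1]; module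
  have x2 : (X - 1) * (H + (1/2:ℝ) • 1) = -((2:ℝ) • H) := by
    rw [sub_mul, x1, one_mul]; module
  have x3 : (H + (1/2:ℝ) • 1) * (X - 1) = -((2:ℝ) • H) := by
    have : (H + (1/2:ℝ) • 1) * (X - 1) = (H + (1/2:ℝ) • 1) * (X+1) - (2:ℝ) • (H + (1/2:ℝ) • 1) := by
      have e : X - 1 = X + 1 - (2:ℝ) • 1 := by module
      rw [e, mul_sub]; simp
    rw [this, c2]; module
  have comm : Commute (X - 1) (H + (1/2:ℝ) • 1) := by
    rw [Commute, SemiconjBy, x2, x3]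
  refine ⟨?_, ?_, ?_, ?_⟩
  · rw [fbMat, hJ]
    have : X * (X - 1) * ((H + (1/2:ℝ) • 1) * (H + (1/2:ℝ) • 1) * (H + (1/2:ℝ) • 1))
       = (X * (H + (1/2:ℝ) • 1)) * ((X - 1) * (H + (1/2:ℝ) • 1)) * (H + (1/2:ℝ) • 1) := by
      have := comm.eq
      calc _ = X * ((X - 1) * (H + (1/2:ℝ) • 1)) * (H + (1/2:ℝ) • 1) * (H + (1/2:ℝ) • 1) := by
            simp only [mul_assoc]
        _ = X * ((H + (1/2:ℝ) • 1) * (X - 1)) * (H + (1/2:ℝ) • 1) * (H + (1/2:ℝ) • 1) := by rw [this]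
        _ = _ := by simp only [mul_assoc]
    rw [this, x1, x2]
    simp only [mul_add, sub_mul, smul_mul_assoc, mul_smul_comm, one_mul, mul_one, mul_neg, neg_mul]
    module
  · rw [lyapV, hJ]
    have : (X - 1) * (X - 1) * ((H + (1/2:ℝ) • 1) * (H + (1/2:ℝ) • 1))
        = ((X - 1) * (H + (1/2:ℝ) • 1)) * ((X - 1) * (H + (1/2:ℝ) • 1)) := by
      have := comm.eq
      calc _ = (X - 1) * ((X - 1) * (H + (1/2:ℝ) • 1)) * (H + (1/2:ℝ) • 1) := by
            simp only [mul_assoc]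
        _ = (X - 1) * ((H + (1/2:ℝ) • 1) * (X - 1)) * (H + (1/2:ℝ) • 1) := by rw [this]
        _ = _ := by simp only [mul_assoc]
    rw [this, x2]
    have : -((2:ℝ) • H) * -((2:ℝ) • H) = (4:ℝ) • (H * H) := by
      simp only [neg_mul_neg, smul_mul_assoc, mul_smul_comm, smul_smul]; norm_num
    rw [this]
    simp [trace_smul]
  · have e : X - 1 = (X - 1) * (H + (1/2:ℝ) • 1) * (X + 1) := by
      rw [mul_assoc, c2, mul_one]
    rw [e, x2]; simp
  · intro hun
    have hXX : X * Xᴴ = 1 := mul_eq_one_comm.1 hun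
    -- Jᴴ = X J
    have d1 : (H + (1/2:ℝ) • 1)ᴴ * (Xᴴ + 1) = 1 := by
      have := congrArg conjTranspose c1
      rwa [conjTranspose_mul, conjTranspose_add X, conjTranspose_one] at this
    have d2 : (Xᴴ + 1) * (X * (H + (1/2:ℝ) • 1)) = 1 := by
      rw [← mul_assoc, add_mul, hun, one_mul, add_comm, c1]
    have d3 : (H + (1/2:ℝ) • 1)ᴴ = X * (H + (1/2:ℝ) • 1) := left_inv_eq_right_inv d1 d2
    rw [x1, conjTranspose_add, conjTranspose_smul, conjTranspose_one] at d3
    simp only [star_trivial] at d3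
    have := eq_sub_of_add_eq d3
    rw [this]; abel

/-- Derivative of `V`. -/
theorem aux_V_deriv (H : ℝ → 𝓜) (A D F : 𝓜) (t : ℝ) (hH : HasDerivAt H D t)
    (hD : D = -((1/4:ℝ) • A) + (1/2:ℝ) • (A * H t) - (1/2:ℝ) • (H t * A) + H t * A * H t)
    (hF : F = -((1/2:ℝ) • H t) + (2:ℝ) • (H t * H t * H t)) :
    HasDerivAt (fun t => -(4 * (H t * H t).trace.re)) (-(4 * (F * A).trace.re)) t := by
  let τ : 𝓜 →ₗ[ℝ] ℝ := Complex.reLm ∘ₗ ((traceLinearMap (Fin n) ℂ ℂ).restrictScalars ℝ)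
  let τc : 𝓜 →L[ℝ] ℝ := LinearMap.toContinuousLinearMap τ
  have hτ : ∀ B, τc B = B.trace.re := fun B => rfl
  have h1 := τc.hasFDerivAt.comp_hasDerivAt t (hH.mul hH)
  have h2 := (h1.const_mul 4).neg
  refine HasDerivAt.congr_deriv (f := fun t => -(4 * (H t * H t).trace.re)) h2 ?_
  change -(4 * (D * H t + H t * D).trace.re) = _
  have e1 : (D * H t + H t * D).trace = 2 * (H t * D).trace := by
    rw [trace_add, trace_mul_comm]; ring
  have t1 : (H t * (A * H t)).trace = (H t * H t * A).trace := by
    rw [← mul_assoc, trace_mul_comm, ← mul_assoc]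
  have t2 : (H t * (H t * A * H t)).trace = (H t * H t * H t * A).trace := by
    rw [← mul_assoc, trace_mul_comm]; simp only [mul_assoc]
  rw [e1, hD, hF]
  simp only [mul_add, mul_sub, mul_neg, mul_smul_comm, add_mul, neg_mul, smul_mul_assoc, trace_add, trace_sub,
    trace_neg, trace_smul, t1, t2, ← mul_assoc (H t) (H t) A]
  simp
  ring


/-- Matrices as vectors of a real inner product space. -/
noncomputable def auxPhi (n : ℕ) :
    Matrix (Fin n) (Fin n) ℂ →ₗ[ℝ] PiLp 2 (fun _ : Fin n × Fin n => ℂ) where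
  toFun A := WithLp.toLp 2 (fun p => A p.1 p.2)
  map_add' A B := by ext p; simp
  map_smul' r A := by ext p; simp

theorem auxPhi_inner (A B : 𝓜) : inner ℝ (auxPhi n A) (auxPhi n B) = (Aᴴ * B).trace.re := by
  rw [PiLp.inner_apply]
  simp only [auxPhi, LinearMap.coe_mk, AddHom.coe_mk, Complex.inner, trace, diag_apply, mul_apply,
    conjTranspose_apply, Complex.re_sum, Fintype.sum_prod_type]
  rw [Finset.sum_comm]
  refine Finset.sum_congr rfl fun i _ => Finset.sum_congr rfl fun j _ => ?_
  rw [mul_comm]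
  rfl

theorem auxPhi_frob (A : 𝓜) : ‖auxPhi n A‖ = frobNorm A := by
  rw [PiLp.norm_eq_of_L2, frobNorm, Fintype.sum_prod_type]
  rfl

theorem aux_frob_eq (A : 𝓜) : frobNorm A = ‖A‖ := by
  rw [frobNorm, frobenius_norm_def, Real.sqrt_eq_rpow]
  simp

theorem auxPhi_norm (A : 𝓜) : ‖auxPhi n A‖ = ‖A‖ := by rw [auxPhi_frob, aux_frob_eq]

theorem auxPhi_continuous : Continuous (auxPhi n) := LinearMap.continuous_of_finiteDimensional _

theorem auxPhi_deriv (X : ℝ → 𝓜) (X' : 𝓜) (t : ℝ) (h : HasDerivAt X X' t) :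
    HasDerivAt (fun t => auxPhi n (X t)) (auxPhi n X') t := by
  exact (LinearMap.toContinuousLinearMap (auxPhi n)).hasFDerivAt.comp_hasDerivAt t h

theorem aux_beta {E : Type*} [NormedAddCommGroup E] [InnerProductSpace ℝ E] [FiniteDimensional ℝ E]
    (m : ℕ) (b : Fin m → ℝ → E) (hb : ∀ k, Continuous (b k)) (T : ℝ)
    (hper : ∀ k t, b k (t + T) = b k t) :
    ∃ β : ℝ → E →L[ℝ] EuclideanSpace ℝ (Fin m), Continuous β ∧ (∀ t, β (t + T) = β t) ∧
      ∀ t v, ContinuousLinearMap.adjoint (β t) (β t v) = ∑ k, (inner ℝ (b k t) v : ℝ) • b k t := by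
  refine ⟨fun t => ∑ k, (innerSL ℝ (b k t)).smulRight (EuclideanSpace.single k (1:ℝ)), ?_, ?_, ?_⟩
  · refine continuous_finsetSum _ fun k _ => ?_
    have h1 : Continuous fun t => innerSL ℝ (b k t) := (innerSL ℝ).continuous.comp (hb k)
    exact ((ContinuousLinearMap.smulRightL ℝ E (EuclideanSpace ℝ (Fin m))).flip
      (EuclideanSpace.single k (1:ℝ))).continuous.comp h1
  · intro t; simp only [hper]
  · intro t v
    refine ext_inner_right ℝ fun w => ?_
    rw [ContinuousLinearMap.adjoint_inner_left, sum_inner]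
    simp only [_root_.sum_apply, ContinuousLinearMap.smulRight_apply, innerSL_apply_apply,
      PiLp.inner_apply, inner_smul_left]
    refine Finset.sum_congr rfl fun k _ => ?_
    simp [Finset.sum_apply, Pi.single_apply, mul_comm]


theorem aux_core (n m : ℕ) (T : ℝ) (hT : 0 < T)
    (f : Fin m → ℝ) (hf : ∀ k, 0 < f k)
    (B : Fin m → ℝ → Matrix (Fin n) (Fin n) ℂ)
    (hBskew : ∀ k t, (B k t)ᴴ = -(B k t)) (hBc : ∀ k, Continuous (B k))
    (hBper : ∀ k t, B k (t + T) = B k t)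
    (X : ℝ → Matrix (Fin n) (Fin n) ℂ)
    (hX0 : (X 0)ᴴ * X 0 = 1)
    (hode : ∀ t ∈ Set.Ici (0 : ℝ), HasDerivWithinAt X
      (∑ k, (f k * ((fbMat (X t) * B k t).trace).re) • (B k t * X t)) (Set.Ici (0 : ℝ)) t)
    (hadm : Filter.Tendsto X Filter.atTop (nhds 1)) :
    ∃ (Ma : ℝ) (L : ℕ), 0 < Ma ∧
      ∀ j : ℕ, L ≤ j →
        lyapV (X ((j + 1 : ℕ) * T)) - lyapV (X (j * T)) ≤
          -Ma * frobNorm (X (j * T) - 1) ^ 2 := by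
  -- unitarity
  have hun : ∀ t, 0 ≤ t → (X t)ᴴ * X t = 1 := by
    intro t ht
    rw [← hX0]
    refine aux_gram_const X (fun t => ∑ k, (f k * ((fbMat (X t) * B k t).trace).re) • B k t)
      (fun t => by simp [conjTranspose_sum, conjTranspose_smul, hBskew]) 0 (fun t ht => ?_) t ht
    refine (hode t ht).congr_deriv ?_
    simp [Finset.sum_mul]
  -- limits
  obtain ⟨H, hH⟩ : ∃ H : ℝ → Matrix (Fin n) (Fin n) ℂ,
      ∀ t, H t = Ring.inverse (X t + 1) - (1/2 : ℝ) • 1 := ⟨_, fun _ => rfl⟩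
  have hX1 : Tendsto (fun t => X t + 1) atTop (nhds (1 + 1)) := hadm.add_const 1
  have e2 : (1 + 1 : Matrix (Fin n) (Fin n) ℂ) = (2:ℝ) • 1 := by module
  let u2 : (Matrix (Fin n) (Fin n) ℂ)ˣ := ⟨(2:ℝ) • 1, (1/2:ℝ) • 1, by simp, by simp⟩
  have hu2 : (1 + 1 : Matrix (Fin n) (Fin n) ℂ) = (u2 : Matrix (Fin n) (Fin n) ℂ) := e2
  have hHlim : Tendsto H atTop (nhds 0) := by
    have h1 : Tendsto (fun t => Ring.inverse (X t + 1)) atTop (nhds (Ring.inverse (1+1))) := by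
      have hi := NormedRing.inverse_continuousAt u2
      rw [← hu2] at hi
      exact Tendsto.comp (g := Ring.inverse) hi hX1
    have h2 := h1.sub_const ((1/2:ℝ) • (1 : Matrix (Fin n) (Fin n) ℂ))
    have e3 : Ring.inverse (1+1) - ((1/2:ℝ) • (1 : Matrix (Fin n) (Fin n) ℂ)) = 0 := by
      rw [hu2, Ring.inverse_unit, sub_eq_zero]; rfl
    rw [e3] at h2
    exact h2.congr fun t => (hH t).symm
  have hunit : ∀ᶠ t in atTop, IsUnit (X t + 1) :=
    hX1.eventually (Units.isOpen.mem_nhds ⟨u2, hu2.symm⟩)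
  have hHsm : ∀ᶠ t in atTop, ‖H t‖ < 1/4 := by
    have := hHlim.norm
    rw [norm_zero] at this
    exact this.eventually (gt_mem_nhds (by norm_num))
  obtain ⟨c1, hc1⟩ : ∃ c1 : ℝ, c1 = ‖(1 + 1 : Matrix (Fin n) (Fin n) ℂ)‖ + 1 := ⟨_, rfl⟩
  have hc1pos : 0 < c1 := by rw [hc1]; positivity
  have hXbd : ∀ᶠ t in atTop, ‖X t + 1‖ < c1 := hX1.norm.eventually (gt_mem_nhds (by rw [hc1]; linarith))
  obtain ⟨t0, ht0⟩ := eventually_atTop.1 ((hunit.and (hHsm.and hXbd)).and (eventually_gt_atTop 0))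
  let Fm : ℝ → Matrix (Fin n) (Fin n) ℂ := fun t => -((1/2:ℝ) • H t) + (2:ℝ) • (H t * H t * H t)
  let Y := fun t => auxPhi n (Fm t)
  let A : ℝ → Matrix (Fin n) (Fin n) ℂ := fun t => ∑ k, (-(f k * inner ℝ (Y t) (auxPhi n (B k t)))) • B k t
  have ids : ∀ t ≥ t0, _ := fun t ht => aux_mat_identities (X t) (H t) (ht0 t ht).1.1 (hH t)
  have hHskew : ∀ t ≥ t0, (H t)ᴴ = -(H t) := fun t ht => (ids t ht).2.2.2 (hun t (ht0 t ht).2.le)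
  have hFskew : ∀ t ≥ t0, (Fm t)ᴴ = -(Fm t) := by
    intro t ht
    simp only [Fm, conjTranspose_add, conjTranspose_neg, conjTranspose_smul, conjTranspose_mul,
      hHskew t ht, star_trivial]
    simp [mul_assoc]
    abel
  have htr : ∀ t ≥ t0, ∀ C, (Fm t * C).trace.re = - inner ℝ (Y t) (auxPhi n C) := by
    intro t ht C
    rw [auxPhi_inner, hFskew t ht]; simp
  have hXder : ∀ t ≥ t0, HasDerivAt X (A t * X t) t := by
    intro t ht
    have h1 := (hode t (ht0 t ht).2.le).hasDerivAt (Ici_mem_nhds (ht0 t ht).2)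
    refine h1.congr_deriv ?_
    simp only [A, Finset.sum_mul, smul_mul_assoc]
    refine Finset.sum_congr rfl fun k _ => ?_
    rw [(ids t ht).1]
    have := htr t ht (B k t)
    simp only [Fm] at this
    rw [this, mul_neg]
  let D : ℝ → Matrix (Fin n) (Fin n) ℂ := fun t =>
    -((1/4:ℝ) • A t) + (1/2:ℝ) • (A t * H t) - (1/2:ℝ) • (H t * A t) + H t * A t * H t
  have hHder : ∀ t ≥ t0, HasDerivAt H (D t) t := fun t ht =>
    aux_H_deriv X (A t) t (hXder t ht) (ht0 t ht).1.1 H hH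
  let Rm : ℝ → Matrix (Fin n) (Fin n) ℂ := fun t =>
    -((1/4:ℝ) • (A t * H t)) + (1/4:ℝ) • (H t * A t) - (1/2:ℝ) • (H t * A t * H t)
        + (2:ℝ) • (D t * H t * H t + H t * D t * H t + H t * H t * D t)
  have hFder : ∀ t ≥ t0, HasDerivAt Fm ((1/8:ℝ) • A t + Rm t) t := fun t ht =>
    aux_F_deriv H (A t) t (hHder t ht) (D t) rfl
  -- the operator
  let b : Fin m → ℝ → PiLp 2 (fun _ : Fin n × Fin n => ℂ) := fun k t => √(f k / 8) • auxPhi n (B k t)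
  obtain ⟨β, hβc, hβper, hβ⟩ := aux_beta m b
    (fun k => by
      have h := (auxPhi_continuous.comp (hBc k)).const_smul (√(f k / 8))
      exact h) T (fun k t => by simp only [b, hBper])
  have hβA : ∀ t, ContinuousLinearMap.adjoint (β t) (β t (Y t)) = -((1/8:ℝ) • auxPhi n (A t)) := by
    intro t
    rw [hβ]
    simp only [A, map_sum, map_smul, Finset.smul_sum, ← Finset.sum_neg_distrib, b, inner_smul_left, smul_smul]
    refine Finset.sum_congr rfl fun k _ => ?_
    rw [← neg_smul]
    congr 1
    have h8 : √(f k / 8) * √(f k / 8) = f k / 8 := Real.mul_self_sqrt (by have := hf k; positivity)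
    rw [real_inner_comm]
    simp only [conj_trivial]
    linear_combination (inner ℝ (Y t) (auxPhi n (B k t))) * h8
  have hHc : ContinuousOn H (Set.Ici t0) := fun t ht => (hHder t ht).continuousAt.continuousWithinAt
  have hFc : ContinuousOn Fm (Set.Ici t0) := fun t ht => (hFder t ht).continuousAt.continuousWithinAt
  have hYc : ContinuousOn Y (Set.Ici t0) := auxPhi_continuous.comp_continuousOn hFc
  have hAc : ContinuousOn A (Set.Ici t0) := by
    refine continuousOn_finsetSum _ fun k _ => ?_
    have i1 : ContinuousOn (fun t => (inner ℝ (Y t) (auxPhi n (B k t)) : ℝ)) (Set.Ici t0) :=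
      hYc.inner (auxPhi_continuous.comp (hBc k)).continuousOn
    have i2 : ContinuousOn (fun t => -(f k * (inner ℝ (Y t) (auxPhi n (B k t)) : ℝ))) (Set.Ici t0) :=
      (continuousOn_const.mul i1).neg
    exact i2.smul (hBc k).continuousOn
  have hDc : ContinuousOn D (Set.Ici t0) :=
    ((((hAc.const_smul (1/4:ℝ)).neg).add ((hAc.mul hHc).const_smul (1/2:ℝ))).sub
      ((hHc.mul hAc).const_smul (1/2:ℝ))).add ((hHc.mul hAc).mul hHc)
  have hRc : ContinuousOn Rm (Set.Ici t0) :=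
    (((((hAc.mul hHc).const_smul (1/4:ℝ)).neg).add ((hHc.mul hAc).const_smul (1/4:ℝ))).sub
      (((hHc.mul hAc).mul hHc).const_smul (1/2:ℝ))).add
      (((((hDc.mul hHc).mul hHc).add ((hHc.mul hDc).mul hHc)).add ((hHc.mul hHc).mul hDc)).const_smul (2:ℝ))
  have hYlim : Tendsto Y atTop (nhds 0) := by
    have h1 : Tendsto Fm atTop (nhds (-((1/2:ℝ) • 0) + (2:ℝ) • (0 * 0 * 0))) :=
      ((hHlim.const_smul (1/2:ℝ)).neg).add (((hHlim.mul hHlim).mul hHlim).const_smul (2:ℝ))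
    have h2 := (auxPhi_continuous.tendsto _).comp h1
    have e : auxPhi n (-((1/2:ℝ) • 0) + (2:ℝ) • (0 * 0 * 0)) = 0 := by simp
    rw [e] at h2
    exact h2
  have hHY : ∀ t ≥ t0, ‖H t‖ ≤ 4 * ‖Y t‖ := by
    intro t ht
    have := aux_F_lower (H t) (ht0 t ht).1.2.1.le
    rw [← auxPhi_norm (-((1/2:ℝ) • H t) + (2:ℝ) • (H t * H t * H t))] at this
    exact this
  have hAn : ∀ t, ‖A t‖ = 8 * ‖ContinuousLinearMap.adjoint (β t) (β t (Y t))‖ := by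
    intro t
    rw [hβA, norm_neg, norm_smul, auxPhi_norm, Real.norm_of_nonneg (by norm_num)]
    ring
  obtain ⟨c, L, hc, hL⟩ := aux_main β hβc T hT hβper 640 t0 (by norm_num) Y (fun t => auxPhi n (Rm t))
    (fun t ht => (auxPhi_deriv Fm _ t (hFder t ht)).congr_deriv (by
      rw [hβA, map_add, map_smul, neg_neg]))
    (auxPhi_continuous.comp_continuousOn hRc)
    (fun t ht => by
      rw [auxPhi_norm]
      have h1 := aux_R_bound (H t) (A t) (D t) (by linarith [(ht0 t ht).1.2.1]) rfl
      refine h1.trans ?_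
      rw [hAn]
      have := mul_le_mul_of_nonneg_right (hHY t ht) (norm_nonneg (ContinuousLinearMap.adjoint (β t) (β t (Y t))))
      linarith) hYlim
  have hTt : Tendsto (fun j : ℕ => (j : ℝ) * T) atTop atTop :=
    tendsto_natCast_atTop_atTop.atTop_mul_const hT
  obtain ⟨L', hL'⟩ := eventually_atTop.1 (hTt.eventually_ge_atTop t0)
  refine ⟨32 * c / (8 * c1)^2, max L L', by positivity, fun j hj => ?_⟩
  have hj1 := hL j ((le_max_left _ _).trans hj)
  have hj2 := hL' j ((le_max_right _ _).trans hj)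
  have hle : (j:ℝ) * T ≤ j * T + T := by linarith
  have hcast : ((j + 1 : ℕ) : ℝ) * T = j * T + T := by push_cast; ring
  rw [hcast, (ids _ hj2).2.1, (ids (j * T + T) (by linarith)).2.1]
  have hsub : Set.uIcc ((j:ℝ) * T) (j * T + T) ⊆ Set.Ici t0 := by
    rw [Set.uIcc_of_le hle]; exact fun t ht => hj2.trans ht.1
  have hVder : ∀ t ≥ t0, HasDerivAt (fun t => -(4 * (H t * H t).trace.re)) (-32 * ‖β t (Y t)‖^2) t := by
    intro t ht
    refine (aux_V_deriv H (A t) (D t) (Fm t) t (hHder t ht) rfl rfl).congr_deriv ?_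
    rw [htr t ht]
    have h1 : auxPhi n (A t) = (-8:ℝ) • ContinuousLinearMap.adjoint (β t) (β t (Y t)) := by
      rw [hβA]; module
    rw [h1, inner_smul_right, ContinuousLinearMap.adjoint_inner_right, real_inner_self_eq_norm_sq]
    ring
  have hFTC := intervalIntegral.integral_eq_sub_of_hasDerivAt
    (fun t ht => hVder t (hsub ht))
    (by
      apply ContinuousOn.intervalIntegrable
      exact (continuousOn_const.mul (((hβc.continuousOn.clm_apply hYc).norm).pow 2)).mono hsub)
  rw [← hFTC, intervalIntegral.integral_const_mul]
  have hXY : frobNorm (X (j*T) - 1) ≤ 8 * c1 * ‖Y (j*T)‖ := by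
    rw [aux_frob_eq, (ids _ hj2).2.2.1, norm_neg, norm_smul, Real.norm_of_nonneg (by norm_num)]
    have h1 := norm_mul_le (H (j*T)) (X (j*T) + 1)
    have h2 : ‖H (j*T)‖ * ‖X (j*T) + 1‖ ≤ (4 * ‖Y (j*T)‖) * c1 :=
      mul_le_mul (hHY _ hj2) (ht0 _ hj2).1.2.2.le (norm_nonneg _) (by positivity)
    linarith
  have h0 : 0 ≤ frobNorm (X (j*T) - 1) := Real.sqrt_nonneg _
  have hsq : frobNorm (X (j*T) - 1)^2 ≤ (8 * c1)^2 * ‖Y (j*T)‖^2 := by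
    rw [← mul_pow]; gcongr
  have hfin : 32 * c / (8 * c1)^2 * frobNorm (X (j*T) - 1)^2 ≤ 32 * (c * ‖Y (j*T)‖^2) := by
    calc _ ≤ 32 * c / (8 * c1)^2 * ((8 * c1)^2 * ‖Y (j*T)‖^2) := by gcongr
      _ = _ := by field_simp
  linarith

end matrixPart

/-- Uniform per-period Lyapunov decrease for admissible amplitudes.
If the amplitude vector `a` is admissible (the closed-loop error trajectory `X̃(t) → I`),
then there are `M_a > 0` and `L ∈ ℕ` such that for all `j ≥ L`,
`V(X̃((j+1)T)) - V(X̃(jT)) ≤ -M_a ‖X̃(jT) - I‖²`. -/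
theorem uniform_lyapunov_decrease
    (n m M : ℕ) (hn : 1 ≤ n) (T : ℝ) (hT : 0 < T)
    (S : Fin m → Matrix (Fin n) (Fin n) ℂ)
    (hS : ∀ k, (S k)ᴴ = -(S k))
    (f : Fin m → ℝ) (hf : ∀ k, 0 < f k)
    (Xgoal : Matrix (Fin n) (Fin n) ℂ)
    (hXgoal : Xgoal ∈ Matrix.unitaryGroup (Fin n) ℂ)
    (hdet : (1 + Xgoal).det ≠ 0)
    (a : Fin m → Fin M → ℝ)
    (ubar : Fin m → ℝ → ℝ)
    (hubar : ubar = fun k t =>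
      ∑ ℓ : Fin M, a k ℓ * Real.sin ((ℓ.1 + 1) * (2 * Real.pi / T) * t))
    -- the T-periodic reference trajectory through X_goal
    (Xbar : ℝ → Matrix (Fin n) (Fin n) ℂ)
    (hXbar0 : Xbar 0 = Xgoal)
    (hXbarode : ∀ t, HasDerivAt Xbar (∑ k, ubar k t • (S k * Xbar t)) t)
    -- the closed-loop error trajectory
    (Xtilde : ℝ → Matrix (Fin n) (Fin n) ℂ)
    (hXtilde0 : Xtilde 0 = Xgoal)
    (hXtildeode : ∀ t ∈ Set.Ici (0 : ℝ), HasDerivWithinAt Xtilde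
      (∑ k, utildeFb (f k) (S k) Xbar (Xtilde t) t • ((Xbar t)ᴴ * S k * Xbar t * Xtilde t))
      (Set.Ici (0 : ℝ)) t)
    -- a is admissible
    (hadm : Filter.Tendsto Xtilde Filter.atTop (nhds 1)) :
    ∃ (Ma : ℝ) (L : ℕ), 0 < Ma ∧
      ∀ j : ℕ, L ≤ j →
        lyapV (Xtilde ((j + 1 : ℕ) * T)) - lyapV (Xtilde (j * T)) ≤
          -Ma * frobNorm (Xtilde (j * T) - 1) ^ 2 := by
  have hper := aux_periodic m M T hT S hS a ubar hubar Xbar hXbarode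
  have hXc : Continuous Xbar := continuous_iff_continuousAt.2 fun t => (hXbarode t).continuousAt
  refine aux_core n m T hT f hf (fun k t => (Xbar t)ᴴ * S k * Xbar t) ?_ ?_ ?_ Xtilde ?_ hXtildeode hadm
  · intro k t
    simp [conjTranspose_mul, hS, mul_assoc]
  · intro k
    exact (hXc.matrix_conjTranspose.matrix_mul continuous_const).matrix_mul hXc
  · intro k t
    simp only [hper]
  · rw [hXtilde0]
    exact (Matrix.mem_unitaryGroup_iff').1 hXgoal
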